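/- arXiv:2605.20601 — 2 statements merged into one kernel-verified Lean document; each statement's English description precedes it below -/
import Mathlib

section
/- Let (Ω,𝓕,P) be a probability space carrying a random vector X : Ω → ℝ^d, random variables U : Ω → [0,1], V : Ω → [0,1], and ε : Ω → ℝ, and let β₀ : [0,1] → ℝ^d be Borel measurable. Define Y = ⟨X, β₀(U)⟩ + ε. Assume (i) ε is independent of the triple (X, V, U) and has a density f_ε with respect to Lebesgue measure on ℝ, (ii) X and U are conditionally independent given the σ-algebra generated by V, and (iii) for (P∘V⁻¹)-almost every v, the regular conditional distribution κ_v of U given V = v has a density f_c(·|v) with respect to Lebesgue measure on [0,1]. Then for (P ∘ (X,V)⁻¹)-almost every (x,v), the regular conditional distribution of Y given (X,V) = (x,v) is absolutely continuous with respect to Lebesgue measure on ℝ with density y ↦ ∫₀¹ f_ε(y − ⟨x, β₀(u)⟩) f_c(u|v) du. -/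
open MeasureTheory ProbabilityTheory
open scoped RealInnerProductSpace

open scoped ENNReal

/-- If `κ` is a conditional law of `U` given `T` and `ε` is independent of `(T, U)`, then the
push-forward of `κ ×ₖ Law(ε)` under `g` is a conditional law of `g (T, U, ε)` given `T`. -/
theorem map_prodMk_eq_compProd_of_indepFun
    {Ω γ α δ δ' : Type*} [MeasurableSpace Ω] [MeasurableSpace γ] [MeasurableSpace α]
    [MeasurableSpace δ] [MeasurableSpace δ']
    {P : Measure Ω} [IsProbabilityMeasure P] {T : Ω → γ} {U : Ω → α} {ε : Ω → δ}
    (hT : Measurable T) (hU : Measurable U) (hε : Measurable ε)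
    (hindep : IndepFun ε (fun ω => (T ω, U ω)) P)
    (κ : Kernel γ α) [IsMarkovKernel κ]
    (hκ : P.map (fun ω => (T ω, U ω)) = P.map T ⊗ₘ κ)
    {g : γ × α × δ → δ'} (hg : Measurable g) :
    P.map (fun ω => (T ω, g (T ω, U ω, ε ω)))
      = P.map T ⊗ₘ (Kernel.id ×ₖ (κ ×ₖ Kernel.const γ (P.map ε))).map g := by
  have : IsProbabilityMeasure (P.map ε) := Measure.isProbabilityMeasure_map hε.aemeasurable
  have hprod : P.map (fun ω => ((T ω, U ω), ε ω))
      = (P.map (fun ω => (T ω, U ω))).prod (P.map ε) :=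
    (indepFun_iff_map_prod_eq_prod_map_map (hT.prodMk hU).aemeasurable hε.aemeasurable).1
      hindep.symm
  refine Measure.ext_of_lintegral _ fun F hF => ?_
  calc ∫⁻ z, F z ∂P.map (fun ω => (T ω, g (T ω, U ω, ε ω)))
      = ∫⁻ z, F (z.1.1, g (z.1.1, z.1.2, z.2)) ∂P.map (fun ω => ((T ω, U ω), ε ω)) := by
        rw [lintegral_map (by fun_prop) (by fun_prop), lintegral_map (by fun_prop) (by fun_prop)]
    _ = ∫⁻ t, ∫⁻ u, ∫⁻ e, F (t, g (t, u, e)) ∂P.map ε ∂κ t ∂P.map T := by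
        rw [hprod, lintegral_prod _ (by fun_prop), hκ, Measure.lintegral_compProd]
        exact Measurable.lintegral_prod_right (by fun_prop)
    _ = ∫⁻ z, F z ∂(P.map T ⊗ₘ (Kernel.id ×ₖ (κ ×ₖ Kernel.const γ (P.map ε))).map g) := by
        rw [Measure.lintegral_compProd hF]
        refine lintegral_congr fun t => ?_
        rw [Kernel.lintegral_map _ hg _ (by fun_prop), Kernel.prod_apply, Kernel.prod_apply,
          Kernel.id_apply, Kernel.const_apply, Measure.dirac_prod,
          lintegral_map (by fun_prop) (by fun_prop), lintegral_prod _ (by fun_prop)]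

/-- The law of `c u + e`, for `(u, e)` distributed according to a product of two finite measures
with densities `g` and `f`, has the convolution-type density `y ↦ ∫ u, f (y - c u) * g u`. -/
theorem map_add_prod_withDensity_ofReal
    {α : Type*} [MeasurableSpace α] {μ : Measure α} [SigmaFinite μ]
    {c g : α → ℝ} {f : ℝ → ℝ} (hc : Measurable c) (hg : Measurable g) (hf : Measurable f)
    (hg0 : ∀ u, 0 ≤ g u) (hf0 : ∀ e, 0 ≤ f e)
    [IsFiniteMeasure (μ.withDensity fun u => ENNReal.ofReal (g u))]
    [IsFiniteMeasure ((volume : Measure ℝ).withDensity fun e => ENNReal.ofReal (f e))] :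
    ((μ.withDensity fun u => ENNReal.ofReal (g u)).prod
        (volume.withDensity fun e => ENNReal.ofReal (f e))).map (fun q => c q.1 + q.2)
      = volume.withDensity fun y => ENNReal.ofReal (∫ u, f (y - c u) * g u ∂μ) := by
  set m := ((μ.withDensity fun u => ENNReal.ofReal (g u)).prod
    (volume.withDensity fun e => ENNReal.ofReal (f e))).map (fun q => c q.1 + q.2) with hm
  have hmeas : Measurable fun y : ℝ => ∫⁻ u, ENNReal.ofReal (f (y - c u) * g u) ∂μ :=
    Measurable.lintegral_prod_right (by fun_prop)
  have hlin : m = volume.withDensity fun y => ∫⁻ u, ENNReal.ofReal (f (y - c u) * g u) ∂μ := by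
    refine Measure.ext_of_lintegral _ fun F hF => ?_
    rw [hm, lintegral_map hF (by fun_prop), lintegral_prod _ (by fun_prop),
      lintegral_withDensity_eq_lintegral_mul _ (by fun_prop)
        (Measurable.lintegral_prod_right (by fun_prop)),
      lintegral_withDensity_eq_lintegral_mul _ hmeas hF]
    calc ∫⁻ u, ENNReal.ofReal (g u)
            * ∫⁻ e, F (c u + e) ∂(volume.withDensity fun e => ENNReal.ofReal (f e)) ∂μ
        = ∫⁻ u, ∫⁻ y : ℝ, ENNReal.ofReal (f (y - c u) * g u) * F y ∂volume ∂μ := by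
          refine lintegral_congr fun u => ?_
          rw [lintegral_withDensity_eq_lintegral_mul _ (by fun_prop) (by fun_prop),
            ← lintegral_const_mul _ (by fun_prop),
            ← lintegral_add_left_eq_self (fun y => ENNReal.ofReal (f (y - c u) * g u) * F y) (c u)]
          refine lintegral_congr fun e => ?_
          rw [Pi.mul_apply, ENNReal.ofReal_mul (hf0 _), add_sub_cancel_left]
          ring
      _ = ∫⁻ y : ℝ, ∫⁻ u, ENNReal.ofReal (f (y - c u) * g u) * F y ∂μ :=
          lintegral_lintegral_swap (by unfold Function.uncurry; fun_prop)
      _ = ∫⁻ y, (∫⁻ u, ENNReal.ofReal (f (y - c u) * g u) ∂μ) * F y :=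
          lintegral_congr fun y => lintegral_mul_const _ (by fun_prop)
  rw [hlin]
  refine withDensity_congr_ae ?_
  have hne : ∫⁻ y, ∫⁻ u, ENNReal.ofReal (f (y - c u) * g u) ∂μ ≠ ∞ := by
    rw [← setLIntegral_univ, ← withDensity_apply _ MeasurableSet.univ, ← hlin]
    exact measure_ne_top m _
  filter_upwards [ae_lt_top hmeas hne] with y hy
  have h0 : ∀ u, 0 ≤ f (y - c u) * g u := fun u => mul_nonneg (hf0 _) (hg0 u)
  have hmy : Measurable fun u => f (y - c u) * g u := by fun_prop
  refine (ofReal_integral_eq_lintegral_ofReal ⟨hmy.aestronglyMeasurable, ?_⟩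
    (Filter.Eventually.of_forall h0)).symm
  rwa [hasFiniteIntegral_iff_ofReal (Filter.Eventually.of_forall h0)]

/-- **Conditional density representation (Proposition 1, density form).** In the model
`Y = ⟨X, β₀(U)⟩ + ε` with `ε ⟂ (X, V, U)` having density `f_ε`, `X ⟂ U | σ(V)`, and the
regular conditional distribution of `U` given `V = v` having density `f_c(·|v)` on `[0,1]`,
for a.e. `(x, v)` under the law of `(X, V)` the regular conditional distribution of `Y`
given `(X, V) = (x, v)` is absolutely continuous w.r.t. Lebesgue measure with density
`y ↦ ∫₀¹ f_ε(y − ⟨x, β₀(u)⟩) f_c(u|v) du`. -/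
theorem condDistrib_eq_withDensity_convolution
    {Ω : Type*} [MeasurableSpace Ω] [StandardBorelSpace Ω] [Nonempty Ω]
    (P : Measure Ω) [IsProbabilityMeasure P]
    {d : ℕ}
    (X : Ω → EuclideanSpace ℝ (Fin d)) (U V ε : Ω → ℝ)
    (β₀ : ℝ → EuclideanSpace ℝ (Fin d))
    (hX : Measurable X) (hU : Measurable U) (hV : Measurable V) (hε : Measurable ε)
    (hβ : Measurable β₀)
    (hUrange : ∀ ω, U ω ∈ Set.Icc (0:ℝ) 1)
    (hVrange : ∀ ω, V ω ∈ Set.Icc (0:ℝ) 1)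
    (Y : Ω → ℝ) (hY : Y = fun ω => ⟪X ω, β₀ (U ω)⟫ + ε ω)
    (hindep : IndepFun ε (fun ω => (X ω, V ω, U ω)) P)
    (fε : ℝ → ℝ) (hfεmeas : Measurable fε) (hfεnn : ∀ e, 0 ≤ fε e)
    (hfεdens : P.map ε = volume.withDensity (fun e => ENNReal.ofReal (fε e)))
    (hcondindep : CondIndepFun (MeasurableSpace.comap V inferInstance)
      (Measurable.comap_le hV) X U P)
    (fc : ℝ → ℝ → ℝ) (hfcmeas : Measurable (Function.uncurry fc))
    (hfcnn : ∀ u v, 0 ≤ fc u v)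
    (hfcdens : ∀ᵐ v ∂(P.map V),
      condDistrib U V P v
        = (volume.restrict (Set.Icc (0:ℝ) 1)).withDensity
            (fun u => ENNReal.ofReal (fc u v))) :
    ∀ᵐ p ∂(P.map (fun ω => (X ω, V ω))),
      condDistrib Y (fun ω => (X ω, V ω)) P p
        = volume.withDensity (fun y => ENNReal.ofReal
            (∫ u in Set.Icc (0:ℝ) 1, fε (y - ⟪p.1, β₀ u⟫) * fc u p.2)) := by
  have hXV : Measurable fun ω => (X ω, V ω) := hX.prodMk hV
  have : IsProbabilityMeasure (P.map ε) := Measure.isProbabilityMeasure_map hε.aemeasurable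
  set κ : Kernel (EuclideanSpace ℝ (Fin d) × ℝ) ℝ :=
    (condDistrib U V P).prodMkLeft (EuclideanSpace ℝ (Fin d)) with hκ
  have hUXV : P.map (fun ω => ((X ω, V ω), U ω)) = P.map (fun ω => (X ω, V ω)) ⊗ₘ κ := by
    have h := (condDistrib_ae_eq_iff_measure_eq_compProd _ hU.aemeasurable _).1
      ((condIndepFun_iff_condDistrib_prod_ae_eq_prodMkRight hU hX hV).1 hcondindep)
    refine Measure.ext_of_lintegral _ fun F hF => ?_
    have h' := congrArg (fun m => ∫⁻ z, F (z.1.swap, z.2) ∂m) h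
    rw [lintegral_map (by fun_prop) (by fun_prop), Measure.lintegral_compProd (by fun_prop)] at h'
    have hG : Measurable fun p => ∫⁻ u, F (p, u) ∂κ p := hF.lintegral_kernel_prod_right'
    rw [lintegral_map hF (by fun_prop), Measure.lintegral_compProd hF,
      lintegral_map hG hXV]
    exact h'.trans (lintegral_map (hG.comp measurable_swap) (hV.prodMk hX))
  set g : (EuclideanSpace ℝ (Fin d) × ℝ) × ℝ × ℝ → ℝ :=
    fun q => ⟪q.1.1, β₀ q.2.1⟫ + q.2.2
  have hg : Measurable g := by fun_prop
  have hjoint := map_prodMk_eq_compProd_of_indepFun hXV hU hε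
    (hindep.comp (φ := id) 
      (ψ := fun q : EuclideanSpace ℝ (Fin d) × ℝ × ℝ => ((q.1, q.2.1), q.2.2)) measurable_id (by fun_prop))
    κ hUXV hg
  have hYm : Measurable Y := by rw [hY]; fun_prop
  have : IsMarkovKernel ((Kernel.id ×ₖ (κ ×ₖ Kernel.const _ (P.map ε))).map g) :=
    Kernel.IsMarkovKernel.map _ hg
  have hcond := condDistrib_ae_eq_of_measure_eq_compProd (μ := P) (fun ω => (X ω, V ω))
    hYm.aemeasurable (κ := (Kernel.id ×ₖ (κ ×ₖ Kernel.const _ (P.map ε))).map g)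
    (by rw [← hjoint, hY])
  have hdens : ∀ᵐ p ∂P.map (fun ω => (X ω, V ω)), condDistrib U V P p.2
      = (volume.restrict (Set.Icc (0:ℝ) 1)).withDensity (fun u => ENNReal.ofReal (fc u p.2)) := by
    rw [show V = Prod.snd ∘ fun ω => (X ω, V ω) from rfl, ← Measure.map_map measurable_snd hXV]
      at hfcdens
    exact ae_of_ae_map measurable_snd.aemeasurable hfcdens
  filter_upwards [hcond, hdens] with p hp hpd
  have hfinε : IsFiniteMeasure
      ((volume : Measure ℝ).withDensity fun e => ENNReal.ofReal (fε e)) := by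
    rw [← hfεdens]; infer_instance
  have hfinU : IsFiniteMeasure ((volume.restrict (Set.Icc (0:ℝ) 1)).withDensity
      fun u => ENNReal.ofReal (fc u p.2)) := by
    rw [← hpd]; infer_instance
  rw [hp, Kernel.map_apply _ hg, Kernel.prod_apply, Kernel.prod_apply, Kernel.id_apply,
    Kernel.const_apply, Measure.dirac_prod, Measure.map_map hg (by fun_prop), hκ,
    Kernel.prodMkLeft_apply, hpd, hfεdens]
  exact map_add_prod_withDensity_ofReal (c := fun u => ⟪p.1, β₀ u⟫) (by fun_prop)
    (hfcmeas.comp (measurable_id.prodMk measurable_const)) hfεmeas (fun u => hfcnn u _) hfεnn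
end

section
/- Let (Ω,𝓕,P) be a probability space carrying a random vector X : Ω → ℝ^d, random variables U : Ω → [0,1], V : Ω → [0,1], and ε : Ω → ℝ, and let β₀ : [0,1] → ℝ^d be Borel measurable with ⟨x, β₀(·)⟩ bounded for each x. Define Y = ⟨X, β₀(U)⟩ + ε. Assume (i) ε is independent of the triple (X, V, U) and (ii) X and U are conditionally independent given the σ-algebra generated by V. Let κ denote a regular conditional distribution of U given V. Then for every s ∈ ℝ, almost surely, E[ exp(i s Y) | σ(X, V) ] = E[ exp(i s ε) ] · ∫_{[0,1]} exp( i s ⟨X, β₀(u)⟩ ) dκ_V(u), where the conditional expectation is the ℂ-valued conditional expectation given the σ-algebra generated by (X, V). -/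
open MeasureTheory ProbabilityTheory
open scoped RealInnerProductSpace

/-- If `f` is independent of `T`, the conditional distribution of `f` given `T` is the law
of `f`. -/
lemma ProbabilityTheory.IndepFun.condDistrib_ae_eq_const
    {Ω α β : Type*} {mΩ : MeasurableSpace Ω} {mα : MeasurableSpace α} {mβ : MeasurableSpace β}
    [StandardBorelSpace α] [Nonempty α] {P : Measure Ω} [IsProbabilityMeasure P]
    {f : Ω → α} {T : Ω → β} (hf : AEMeasurable f P) (hT : AEMeasurable T P)
    (h : IndepFun T f P) :
    condDistrib f T P =ᵐ[P.map T] Kernel.const β (P.map f) := by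
  refine condDistrib_ae_eq_of_measure_eq_compProd T hf ?_
  rw [Measure.compProd_const, (indepFun_iff_map_prod_eq_prod_map_map hT hf).1 h]

/-- A factor independent of `T` comes out of the conditional expectation of a product given any
sub-σ-algebra of `σ(T)` as its mean. -/
lemma ProbabilityTheory.IndepFun.condExp_mul_ae_eq
    {Ω α β : Type*} {mΩ : MeasurableSpace Ω} {mα : MeasurableSpace α} {mβ : MeasurableSpace β}
    [StandardBorelSpace α] [Nonempty α] {P : Measure Ω} [IsProbabilityMeasure P]
    {f : Ω → α} {T : Ω → β} (hf : Measurable f) (hT : Measurable T) (h : IndepFun T f P)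
    {m : MeasurableSpace Ω} (hm : m ≤ mβ.comap T) {φ : α → ℂ} {ψ : β → ℂ}
    (hφ : StronglyMeasurable φ) (hψ : StronglyMeasurable ψ)
    (hint : Integrable (fun ω => φ (f ω) * ψ (T ω)) P) :
    P[fun ω => φ (f ω) * ψ (T ω) | m] =ᵐ[P]
      fun ω => (∫ ω', φ (f ω') ∂P) * P[fun ω' => ψ (T ω') | m] ω := by
  have hmeas : StronglyMeasurable (fun p : β × α => φ p.2 * ψ p.1) :=
    (hφ.comp_measurable measurable_snd).mul (hψ.comp_measurable measurable_fst)
  have hT_cond : P[fun ω => φ (f ω) * ψ (T ω) | mβ.comap T] =ᵐ[P]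
      (∫ ω', φ (f ω') ∂P) • fun ω => ψ (T ω) := by
    filter_upwards [condExp_prod_ae_eq_integral_condDistrib hT hf.aemeasurable hmeas hint,
      ae_of_ae_map hT.aemeasurable
        (h.condDistrib_ae_eq_const hf.aemeasurable hT.aemeasurable)] with ω h₁ h₂
    rw [h₁, h₂, Kernel.const_apply, integral_mul_const,
      integral_map hf.aemeasurable hφ.aestronglyMeasurable]
    rfl
  calc P[fun ω => φ (f ω) * ψ (T ω) | m]
      =ᵐ[P] P[P[fun ω => φ (f ω) * ψ (T ω) | mβ.comap T] | m] :=
        (condExp_condExp_of_le hm hT.comap_le).symm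
    _ =ᵐ[P] P[(∫ ω', φ (f ω') ∂P) • fun ω => ψ (T ω) | m] := condExp_congr_ae hT_cond
    _ =ᵐ[P] fun ω => (∫ ω', φ (f ω') ∂P) * P[fun ω' => ψ (T ω') | m] ω := condExp_smul _ _ _

/-- If `X` and `U` are conditionally independent given `V`, conditional expectations given
`(X, V)` of functions of `(X, U)` are integrals against the conditional distribution of `U`
given `V`. -/
lemma ProbabilityTheory.CondIndepFun.condExp_prod_ae_eq_integral_condDistrib
    {Ω α β γ F : Type*} {mΩ : MeasurableSpace Ω} [StandardBorelSpace Ω]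
    {mα : MeasurableSpace α} {mβ : MeasurableSpace β} {mγ : MeasurableSpace γ}
    [StandardBorelSpace α] [Nonempty α] [StandardBorelSpace β] [Nonempty β]
    [NormedAddCommGroup F] [NormedSpace ℝ F] [CompleteSpace F]
    {P : Measure Ω} [IsFiniteMeasure P] {X : Ω → α} {U : Ω → β} {V : Ω → γ}
    (hX : Measurable X) (hU : Measurable U) (hV : Measurable V)
    (h : CondIndepFun (mγ.comap V) hV.comap_le X U P) {g : α × β → F}
    (hg : StronglyMeasurable g) (hint : Integrable (fun ω => g (X ω, U ω)) P) :
    P[fun ω => g (X ω, U ω) | MeasurableSpace.comap (fun ω => (X ω, V ω)) inferInstance] =ᵐ[P]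
      fun ω => ∫ u, g (X ω, u) ∂(condDistrib U V P (V ω)) := by
  have hcomap : MeasurableSpace.comap (fun ω => (X ω, V ω)) inferInstance =
      MeasurableSpace.comap (fun ω => (V ω, X ω)) Prod.instMeasurableSpace := by
    refine .trans (congrArg _ MeasurableEquiv.prodComm.measurableEmbedding.comap_eq.symm) ?_
    exact MeasurableSpace.comap_comp
  have hVX : Measurable fun ω => (V ω, X ω) := hV.prodMk hX
  have hker := (condIndepFun_iff_condDistrib_prod_ae_eq_prodMkRight hU hX hV).1 h
  rw [hcomap]
  filter_upwards [ProbabilityTheory.condExp_prod_ae_eq_integral_condDistrib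
    (f := fun p : (γ × α) × β => g (p.1.2, p.2)) hVX hU.aemeasurable
    (hg.comp_measurable (by fun_prop)) hint, ae_of_ae_map hVX.aemeasurable hker] with ω h₁ h₂
  rw [h₁, h₂, Kernel.prodMkRight_apply]

/-- **Conditional characteristic function factorization.** In the model
`Y = ⟨X, β₀(U)⟩ + ε` with `ε ⟂ (X, V, U)` and `X ⟂ U | σ(V)`, for every `s ∈ ℝ`, almost
surely `E[exp(i s Y) | σ(X, V)] = E[exp(i s ε)] · ∫_{[0,1]} exp(i s ⟨X, β₀(u)⟩) dκ_V(u)`,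
where `κ` is a regular conditional distribution of `U` given `V`. -/
theorem condexp_charFun_factorization
    {Ω : Type*} [MeasurableSpace Ω] [StandardBorelSpace Ω] [Nonempty Ω]
    (P : Measure Ω) [IsProbabilityMeasure P]
    {d : ℕ}
    (X : Ω → EuclideanSpace ℝ (Fin d)) (U V ε : Ω → ℝ)
    (β₀ : ℝ → EuclideanSpace ℝ (Fin d))
    (hX : Measurable X) (hU : Measurable U) (hV : Measurable V) (hε : Measurable ε)
    (hβ : Measurable β₀)
    (hβbdd : ∀ x : EuclideanSpace ℝ (Fin d), ∃ C : ℝ, ∀ u ∈ Set.Icc (0:ℝ) 1, |⟪x, β₀ u⟫| ≤ C)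
    (hUrange : ∀ ω, U ω ∈ Set.Icc (0:ℝ) 1)
    (hVrange : ∀ ω, V ω ∈ Set.Icc (0:ℝ) 1)
    (Y : Ω → ℝ) (hY : Y = fun ω => ⟪X ω, β₀ (U ω)⟫ + ε ω)
    (hindep : IndepFun ε (fun ω => (X ω, V ω, U ω)) P)
    (hcondindep : CondIndepFun (MeasurableSpace.comap V inferInstance)
      (Measurable.comap_le hV) X U P) :
    ∀ s : ℝ,
      P[(fun ω => Complex.exp (Complex.I * (s : ℂ) * (Y ω : ℂ))) |
          MeasurableSpace.comap (fun ω => (X ω, V ω)) inferInstance]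
        =ᵐ[P] fun ω =>
          (∫ ω', Complex.exp (Complex.I * (s : ℂ) * (ε ω' : ℂ)) ∂P) *
            ∫ u in Set.Icc (0:ℝ) 1,
              Complex.exp (Complex.I * (s : ℂ) * (⟪X ω, β₀ u⟫ : ℂ))
                ∂(condDistrib U V P (V ω)) := by
  intro s
  subst hY
  set φ : ℝ → ℂ := fun e => Complex.exp (Complex.I * (s : ℂ) * (e : ℂ)) with hφ_def
  have hφ : StronglyMeasurable φ := Continuous.stronglyMeasurable (by fun_prop)
  have hφ_norm (e : ℝ) : ‖φ e‖ = 1 := by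
    rw [hφ_def]
    dsimp only
    rw [mul_assoc, mul_comm, ← Complex.ofReal_mul, Complex.norm_exp_ofReal_mul_I]
  set g : EuclideanSpace ℝ (Fin d) × ℝ → ℂ :=
    (Set.univ ×ˢ Set.Icc (0:ℝ) 1).indicator fun p => φ ⟪p.1, β₀ p.2⟫ with hg_def
  have hg : StronglyMeasurable g :=
    (hφ.comp_measurable (by fun_prop)).indicator (MeasurableSet.univ.prod measurableSet_Icc)
  have hg_norm (p) : ‖g p‖ ≤ 1 := (norm_indicator_le_norm_self _ _).trans (hφ_norm _).le
  have hgU (ω : Ω) : g (X ω, U ω) = φ ⟪X ω, β₀ (U ω)⟫ := by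
    simp [hg_def, Set.mem_Icc.1 (hUrange ω)]
  have hgXU : Measurable fun ω => g (X ω, U ω) := hg.measurable.comp (hX.prodMk hU)
  have hg_int : Integrable (fun ω => g (X ω, U ω)) P :=
    .of_bound hgXU.aestronglyMeasurable 1 (.of_forall fun ω => hg_norm _)
  have hφg_int : Integrable (fun ω => φ (ε ω) * g (X ω, U ω)) P :=
    .of_bound ((hφ.measurable.comp hε).mul hgXU).aestronglyMeasurable 1
      (.of_forall fun ω => by simpa [hφ_norm] using hg_norm (X ω, U ω))
  have hfactor : (fun ω => Complex.exp (Complex.I * (s : ℂ) *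
      ((⟪X ω, β₀ (U ω)⟫ + ε ω : ℝ) : ℂ))) = fun ω => φ (ε ω) * g (X ω, U ω) := by
    ext ω
    rw [hgU, ← Complex.exp_add]
    push_cast
    ring_nf
  have hle : MeasurableSpace.comap (fun ω => (X ω, V ω)) inferInstance ≤
      MeasurableSpace.comap (fun ω => (X ω, V ω, U ω)) inferInstance :=
    Measurable.comap_le <| Measurable.comp (g := fun t : _ × ℝ × ℝ => (t.1, t.2.1))
      (by fun_prop) (comap_measurable fun ω => (X ω, V ω, U ω))
  rw [hfactor]
  filter_upwards [hindep.symm.condExp_mul_ae_eq hε (hX.prodMk (hV.prodMk hU)) hle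
      (ψ := fun t => g (t.1, t.2.2)) hφ (hg.comp_measurable (by fun_prop)) hφg_int,
    hcondindep.condExp_prod_ae_eq_integral_condDistrib hX hU hV hg hg_int] with ω h₁ h₂
  rw [h₁, h₂, ← integral_indicator measurableSet_Icc]
  congr 2 with u
  simp [hg_def, hφ_def, Set.indicator]
end
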